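/- Every 3-quasi-Sasakian manifold of rank 4l+3 admits a canonical transversal hyper-Kähler structure: the distribution E^{4l+3} = E^{4l} ⊕ V is integrable and defines a Riemannian foliation whose leaves (with the induced structures) are 3-α-Sasakian manifolds, and the tensor fields φ_1, φ_2, φ_3, the fundamental 2-forms Φ_α and the metric g project, with respect to this foliation, onto a hyper-Kähler structure on the (local) leaf space. -/

import Mathlib

/-!
An abstract (Lie–Rinehart style) algebraic model of the differential geometry of
almost contact metric 3-structures: `F` plays the role of the algebra of smooth
functions on a manifold `M` of dimension `4n+3`, and `V` plays the role of the
`F`-module of smooth vector fields, acting on `F` by derivations and carrying a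
Lie bracket, a Riemannian metric `g`, and three almost contact metric structures
`(φ_α, ξ_α, η_α, g)`.
-/

noncomputable section

namespace QS3

/-- Cyclic (= even) permutations of `{0,1,2}`, modelling even permutations of `{1,2,3}`. -/
def Cyclic (a b c : Fin 3) : Prop :=
  (a, b, c) = (0, 1, 2) ∨ (a, b, c) = (1, 2, 0) ∨ (a, b, c) = (2, 0, 1)

/-- The algebraic model of the smooth structure of a manifold: an `ℝ`-algebra `F`
of smooth functions and an `F`-module `V` of vector fields acting on `F` by
derivations and carrying the Lie bracket of vector fields. -/
class SmoothSetting (F : Type) (V : Type) [CommRing F] [Algebra ℝ F]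
    [AddCommGroup V] [Module F V] where
  act : V → F → F
  bracket : V → V → V
  act_add : ∀ (X : V) (f₁ f₂ : F), act X (f₁ + f₂) = act X f₁ + act X f₂
  act_mul : ∀ (X : V) (f₁ f₂ : F), act X (f₁ * f₂) = act X f₁ * f₂ + f₁ * act X f₂
  act_const : ∀ (X : V) (r : ℝ), act X (algebraMap ℝ F r) = 0
  act_addLeft : ∀ (X Y : V) (f : F), act (X + Y) f = act X f + act Y f
  act_smulLeft : ∀ (f : F) (X : V) (h : F), act (f • X) h = f * act X h
  bracket_antisymm : ∀ X Y : V, bracket X Y = -bracket Y X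
  bracket_addLeft : ∀ X Y Z : V, bracket (X + Y) Z = bracket X Z + bracket Y Z
  bracket_act : ∀ (X Y : V) (f : F),
    act (bracket X Y) f = act X (act Y f) - act Y (act X f)
  bracket_smulRight : ∀ (X : V) (f : F) (Y : V),
    bracket X (f • Y) = f • bracket X Y + act X f • Y
  jacobi : ∀ X Y Z : V,
    bracket X (bracket Y Z) + bracket Y (bracket Z X) + bracket Z (bracket X Y) = 0

section d

variable (F V : Type) [CommRing F] [Algebra ℝ F] [AddCommGroup V] [Module F V]
  [SmoothSetting F V]

/-- The action of a vector field on a function (directional derivative). -/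
def der (X : V) (f : F) : F := SmoothSetting.act X f

/-- The Lie bracket of vector fields. -/
def lie (X Y : V) : V := SmoothSetting.bracket F X Y

/-- Exterior differential of a 1-form (with the `1/2` normalization convention,
so that `2 dθ(X,Y) = X θ(Y) - Y θ(X) - θ([X,Y])`). -/
def dOne (θ : V → F) (X Y : V) : F :=
  (2 : ℝ)⁻¹ • (der F V X (θ Y) - der F V Y (θ X) - θ (lie F V X Y))

/-- Exterior differential of a 2-form (with the `1/3` normalization convention). -/
def dTwo (ω : V → V → F) (X Y Z : V) : F :=
  (3 : ℝ)⁻¹ • (der F V X (ω Y Z) + der F V Y (ω Z X) + der F V Z (ω X Y)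
    - ω (lie F V X Y) Z - ω (lie F V Y Z) X - ω (lie F V Z X) Y)

end d

/-- An almost contact metric 3-structure on a manifold of dimension `4n+3`:
three almost contact metric structures `(φ_α, ξ_α, η_α, g)` satisfying the
quaternionic-type relations, together with a (local) orthonormal frame. -/
class ACM3 (F V : Type) [CommRing F] [Algebra ℝ F] [AddCommGroup V] [Module F V]
    [SmoothSetting F V] where
  n : ℕ
  g : V → V → F
  phi : Fin 3 → V → V
  xi : Fin 3 → V
  eta : Fin 3 → V → F
  g_symm : ∀ X Y, g X Y = g Y X
  g_addLeft : ∀ X Y Z, g (X + Y) Z = g X Z + g Y Z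
  g_smulLeft : ∀ (f : F) (X Y : V), g (f • X) Y = f * g X Y
  g_nondeg : ∀ X, (∀ Y, g X Y = 0) → X = 0
  phi_add : ∀ α (X Y : V), phi α (X + Y) = phi α X + phi α Y
  phi_smul : ∀ α (f : F) (X : V), phi α (f • X) = f • phi α X
  eta_eq : ∀ α X, eta α X = g X (xi α)
  acm_sq : ∀ α X, phi α (phi α X) = -X + eta α X • xi α
  eta_xi : ∀ α, eta α (xi α) = 1
  compat : ∀ α X Y, g (phi α X) (phi α Y) = g X Y - eta α X * eta α Y
  quat_phi : ∀ a b c, Cyclic a b c → ∀ X, phi c X = phi a (phi b X) - eta b X • xi a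
  quat_phi' : ∀ a b c, Cyclic a b c → ∀ X, phi c X = -(phi b (phi a X)) + eta a X • xi b
  quat_xi : ∀ a b c, Cyclic a b c → xi c = phi a (xi b)
  quat_xi' : ∀ a b c, Cyclic a b c → xi c = -(phi b (xi a))
  quat_eta : ∀ a b c, Cyclic a b c → ∀ X, eta c X = eta a (phi b X)
  quat_eta' : ∀ a b c, Cyclic a b c → ∀ X, eta c X = -(eta b (phi a X))
  frame : Fin (4 * n + 3) → V
  frame_orth : ∀ i j, g (frame i) (frame j) = if i = j then 1 else 0
  frame_span : ∀ X : V, X = ∑ i, g X (frame i) • frame i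

section acm

variable (F V : Type) [CommRing F] [Algebra ℝ F] [AddCommGroup V] [Module F V]
  [SmoothSetting F V] [ACM3 F V]

/-- The integer `n` (the manifold has dimension `4n+3`). -/
def dimn : ℕ := ACM3.n F V

/-- The Riemannian metric. -/
def gm (X Y : V) : F := ACM3.g X Y

/-- The structure tensors `φ_α`. -/
def ph (α : Fin 3) (X : V) : V := ACM3.phi F α X

/-- The Reeb vector fields `ξ_α`. -/
def rxi (α : Fin 3) : V := ACM3.xi F α

/-- The 1-forms `η_α`. -/
def et (α : Fin 3) (X : V) : F := ACM3.eta α X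

/-- The orthonormal frame. -/
def fr (i : Fin (4 * dimn F V + 3)) : V := ACM3.frame i

/-- The fundamental 2-form `Φ_α(X,Y) = g(X, φ_α Y)`. -/
def Phi (α : Fin 3) (X Y : V) : F := gm F V X (ph F V α Y)

/-- The Nijenhuis torsion `[φ_α, φ_α]` of `φ_α`. -/
def Nij (α : Fin 3) (X Y : V) : V :=
  ph F V α (ph F V α (lie F V X Y)) + lie F V (ph F V α X) (ph F V α Y)
    - ph F V α (lie F V (ph F V α X) Y) - ph F V α (lie F V X (ph F V α Y))

/-- The normality tensor `N⁽¹⁾_α = [φ_α, φ_α] + 2 dη_α ⊗ ξ_α`. -/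
def NOne (α : Fin 3) (X Y : V) : V :=
  Nij F V α X Y + ((2 : ℝ) • dOne F V (et F V α) X Y) • rxi F V α

/-- The structure `(φ_α, ξ_α, η_α)` is normal. -/
def IsNormal (α : Fin 3) : Prop := ∀ X Y, NOne F V α X Y = 0

/-- A 2-form is closed. -/
def IsClosedTwo (ω : V → V → F) : Prop := ∀ X Y Z, dTwo F V ω X Y Z = 0

/-- The structure `(φ_α, ξ_α, η_α, g)` is quasi-Sasakian: normal with closed
fundamental 2-form. -/
def IsQuasiSasakian (α : Fin 3) : Prop :=
  IsNormal F V α ∧ IsClosedTwo F V (Phi F V α)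

/-- `M` is 3-cosymplectic: each structure is normal with `dη_α = 0` and `dΦ_α = 0`. -/
def ThreeCosymplectic : Prop :=
  ∀ α, IsNormal F V α ∧ (∀ X Y, dOne F V (et F V α) X Y = 0) ∧
    IsClosedTwo F V (Phi F V α)

/-- `M` is 3-α-Sasakian with constant `a ≠ 0`: each structure is normal (an
`α`-Sasakian structure) and `dη_δ = a Φ_δ`. -/
def Is3AlphaSasakianWith (a : ℝ) : Prop :=
  a ≠ 0 ∧ (∀ δ, IsNormal F V δ) ∧
    ∀ (δ : Fin 3) (X Y : V), dOne F V (et F V δ) X Y = algebraMap ℝ F a * Phi F V δ X Y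

/-- A vector field is horizontal: it lies in `H = ∩_α ker η_α`. -/
def Horiz (X : V) : Prop := ∀ α, et F V α X = 0

/-- A vector field is vertical: it lies in `V = ⟨ξ₁, ξ₂, ξ₃⟩`. -/
def InVert (X : V) : Prop :=
  ∃ p q r : F, X = p • rxi F V 0 + q • rxi F V 1 + r • rxi F V 2

/-- The distribution `E^{4m} = {X ∈ H : i_X dη_α = 0}`. -/
def InE4m (X : V) : Prop :=
  Horiz F V X ∧ ∀ (α : Fin 3) (Y : V), dOne F V (et F V α) X Y = 0

/-- The distribution `E^{4l}`: the orthogonal complement of `E^{4m}` in `H`. -/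
def InE4l (X : V) : Prop :=
  Horiz F V X ∧ ∀ Y, InE4m F V Y → gm F V X Y = 0

/-- The distribution `E^{4l+3} = E^{4l} ⊕ V`. -/
def InE4l3 (X : V) : Prop :=
  ∃ Y Z, InE4l F V Y ∧ InVert F V Z ∧ X = Y + Z

/-- The distribution `E^{4m+3} = E^{4m} ⊕ V`. -/
def InE4m3 (X : V) : Prop :=
  ∃ Y Z, InE4m F V Y ∧ InVert F V Z ∧ X = Y + Z

/-- The horizontal component `X_H = X - ∑_α η_α(X) ξ_α` of a vector field. -/
def horComp (X : V) : V := X - ∑ α : Fin 3, et F V α X • rxi F V α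

/-- A vector field is basic with respect to the foliation defined by `E^{4m}`. -/
def BasicE4m (X : V) : Prop :=
  InE4l3 F V X ∧ ∀ W, InE4m F V W → InE4m F V (lie F V W X)

/-- A vector field is basic with respect to the foliation defined by `E^{4l+3}`. -/
def BasicE4l3 (X : V) : Prop :=
  InE4m F V X ∧ ∀ W, InE4l3 F V W → InE4l3 F V (lie F V W X)

end acm

/-- A 3-quasi-Sasakian structure: each of the three almost contact metric
structures is quasi-Sasakian.  We also record, as part of the structure, the
standard structural facts established for such manifolds in the literature
(Cappelletti Montano–De Nicola–Dileo): the Reeb commutation relations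
`[ξ_α, ξ_β] = c ξ_γ`, the splitting `H = E^{4l} ⊕ E^{4m}` (constancy of the
rank), the `φ_α`-invariance of both distributions, and the tensors `ψ_α`
(equal to `φ_α` on `E^{4l+3}` and vanishing on `E^{4m}` when the rank is
`4l+3`, i.e. `c ≠ 0`; equal to `φ_α` on `E^{4l}` and vanishing on `E^{4m+3}`
when the rank is `4l+1`, i.e. `c = 0`). -/
class ThreeQS (F V : Type) [CommRing F] [Algebra ℝ F] [AddCommGroup V] [Module F V]
    [SmoothSetting F V] [ACM3 F V] where
  qs : ∀ α, IsQuasiSasakian F V α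
  c : ℝ
  reeb_bracket : ∀ a b c', Cyclic a b c' →
    lie F V (rxi F V a) (rxi F V b) = algebraMap ℝ F c • rxi F V c'
  horiz_split : ∀ X, Horiz F V X → ∃ Y Z, InE4l F V Y ∧ InE4m F V Z ∧ X = Y + Z
  phi_E4l : ∀ α X, InE4l F V X → InE4l F V (ph F V α X)
  phi_E4m : ∀ α X, InE4m F V X → InE4m F V (ph F V α X)
  psi : Fin 3 → V → V
  psi_add : ∀ α (X Y : V), psi α (X + Y) = psi α X + psi α Y
  psi_smul : ∀ α (f : F) (X : V), psi α (f • X) = f • psi α X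
  psi_E4l : ∀ α X, InE4l F V X → psi α X = ph F V α X
  psi_E4m : ∀ α X, InE4m F V X → psi α X = 0
  psi_vert_of_ne : c ≠ 0 → ∀ α β, psi α (rxi F V β) = ph F V α (rxi F V β)
  psi_vert_of_eq : c = 0 → ∀ α β, psi α (rxi F V β) = 0

section tqs

variable (F V : Type) [CommRing F] [Algebra ℝ F] [AddCommGroup V] [Module F V]
  [SmoothSetting F V] [ACM3 F V] [ThreeQS F V]

/-- The constant `c` with `[ξ_α, ξ_β] = c ξ_γ`. -/
def cc : ℝ := ThreeQS.c F V

/-- The tensors `ψ_α`. -/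
def psiT (α : Fin 3) (X : V) : V := ThreeQS.psi F α X

/-- The tensors `θ_α = φ_α - ψ_α`. -/
def thetaT (α : Fin 3) (X : V) : V := ph F V α X - psiT F V α X

/-- The 2-forms `Θ_α(X,Y) = g(X, θ_α Y)`. -/
def ThetaForm (α : Fin 3) (X Y : V) : F := gm F V X (thetaT F V α Y)

end tqs

/-- The 3-quasi-Sasakian manifold has rank `4l+3`: the constant `c` is nonzero
and the orthonormal frame is adapted to the splitting
`TM = E^{4l} ⊕ E^{4m} ⊕ ⟨ξ₁,ξ₂,ξ₃⟩` with `dim E^{4l} = 4l` (hence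
`dim E^{4m} = 4m`, `m = n - l`, and the rank of the `η_α` is `4l+3`). -/
class HasRank (F V : Type) [CommRing F] [Algebra ℝ F] [AddCommGroup V] [Module F V]
    [SmoothSetting F V] [ACM3 F V] [ThreeQS F V] (l : ℕ) : Prop where
  c_ne : cc F V ≠ 0
  l_le : l ≤ dimn F V
  frame_E4l : ∀ i : Fin (4 * dimn F V + 3), i.val < 4 * l → InE4l F V (fr F V i)
  frame_E4m : ∀ i : Fin (4 * dimn F V + 3), 4 * l ≤ i.val → i.val < 4 * dimn F V →
    InE4m F V (fr F V i)
  frame_xi : ∀ (i : Fin (4 * dimn F V + 3)) (a : Fin 3),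
    i.val = 4 * dimn F V + a.val → fr F V i = rxi F V a

/-- The Levi-Civita connection of `g`: the unique torsion-free metric connection. -/
class LeviCivita (F V : Type) [CommRing F] [Algebra ℝ F] [AddCommGroup V] [Module F V]
    [SmoothSetting F V] [ACM3 F V] where
  nabla : V → V → V
  nabla_addLeft : ∀ X Y Z : V, nabla (X + Y) Z = nabla X Z + nabla Y Z
  nabla_smulLeft : ∀ (f : F) (X Y : V), nabla (f • X) Y = f • nabla X Y
  nabla_addRight : ∀ X Y Z : V, nabla X (Y + Z) = nabla X Y + nabla X Z
  nabla_leibniz : ∀ (X : V) (f : F) (Y : V),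
    nabla X (f • Y) = der F V X f • Y + f • nabla X Y
  nabla_metric : ∀ X Y Z : V,
    der F V X (gm F V Y Z) = gm F V (nabla X Y) Z + gm F V Y (nabla X Z)
  nabla_torsionFree : ∀ X Y : V, nabla X Y - nabla Y X = lie F V X Y

section curv

variable (F V : Type) [CommRing F] [Algebra ℝ F] [AddCommGroup V] [Module F V]
  [SmoothSetting F V] [ACM3 F V] [LeviCivita F V]

/-- The Levi-Civita covariant derivative `∇_X Y`. -/
def nab (X Y : V) : V := LeviCivita.nabla F X Y

/-- The Riemannian curvature `R(X,Y)Z = ∇_X ∇_Y Z - ∇_Y ∇_X Z - ∇_{[X,Y]} Z`. -/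
def Rcurv (X Y Z : V) : V :=
  nab F V X (nab F V Y Z) - nab F V Y (nab F V X Z) - nab F V (lie F V X Y) Z

/-- The Ricci tensor `Ric(X,Y) = ∑_i g(R(e_i, X)Y, e_i)`. -/
def Ric (X Y : V) : F :=
  ∑ i, gm F V (Rcurv F V (fr F V i) X Y) (fr F V i)

/-- The scalar curvature. -/
def Scal : F := ∑ i, Ric F V (fr F V i) (fr F V i)

/-- `M` is Einstein: `Ric = a g` for a constant `a`. -/
def Einstein : Prop :=
  ∃ a : ℝ, ∀ X Y, Ric F V X Y = algebraMap ℝ F a * gm F V X Y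

/-- `M` is η-Einstein: `Ric = a g + b ∑_α η_α ⊗ η_α` for constants `a, b`. -/
def EtaEinstein : Prop :=
  ∃ a b : ℝ, ∀ X Y, Ric F V X Y
    = algebraMap ℝ F a * gm F V X Y
      + algebraMap ℝ F b * ∑ α : Fin 3, et F V α X * et F V α Y

end curv

/-- A (Koszul) linear connection on vector fields. -/
def IsConnection (F V : Type) [CommRing F] [Algebra ℝ F] [AddCommGroup V] [Module F V]
    [SmoothSetting F V] (D : V → V → V) : Prop :=
  (∀ X Y Z : V, D (X + Y) Z = D X Z + D Y Z) ∧
  (∀ (f : F) (X Y : V), D (f • X) Y = f • D X Y) ∧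
  (∀ X Y Z : V, D X (Y + Z) = D X Y + D X Z) ∧
  (∀ (X : V) (f : F) (Y : V), D X (f • Y) = der F V X f • Y + f • D X Y)

end QS3

namespace QS3

section calculus

variable {F V : Type} [CommRing F] [Algebra ℝ F] [AddCommGroup V] [Module F V]
  [SmoothSetting F V]

theorem der_add (X : V) (f h : F) : der F V X (f + h) = der F V X f + der F V X h :=
  SmoothSetting.act_add X f h

theorem der_mul (X : V) (f h : F) :
    der F V X (f * h) = der F V X f * h + f * der F V X h :=
  SmoothSetting.act_mul X f h

theorem der_algebraMap (X : V) (r : ℝ) : der F V X (algebraMap ℝ F r) = 0 :=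
  SmoothSetting.act_const X r

theorem der_zero (X : V) : der F V X 0 = 0 := by
  simpa using der_algebraMap (F := F) X 0

theorem der_one (X : V) : der F V X 1 = 0 := by
  simpa using der_algebraMap (F := F) X 1

theorem der_neg (X : V) (f : F) : der F V X (-f) = -der F V X f := by
  have h := der_add X f (-f)
  rw [add_neg_cancel, der_zero] at h
  linear_combination -h

theorem der_sub (X : V) (f h : F) : der F V X (f - h) = der F V X f - der F V X h := by
  rw [sub_eq_add_neg, der_add, der_neg, sub_eq_add_neg]

theorem der_const_mul (X : V) (r : ℝ) (f : F) :
    der F V X (algebraMap ℝ F r * f) = algebraMap ℝ F r * der F V X f := by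
  rw [der_mul, der_algebraMap, zero_mul, zero_add]

theorem der_lie (X Y : V) (f : F) :
    der F V (lie F V X Y) f = der F V X (der F V Y f) - der F V Y (der F V X f) :=
  SmoothSetting.bracket_act X Y f

theorem lie_swap (X Y : V) : lie F V X Y = -lie F V Y X :=
  SmoothSetting.bracket_antisymm X Y

theorem lie_add_left (X Y Z : V) : lie F V (X + Y) Z = lie F V X Z + lie F V Y Z :=
  SmoothSetting.bracket_addLeft X Y Z

theorem lie_add_right (X Y Z : V) : lie F V X (Y + Z) = lie F V X Y + lie F V X Z := by
  rw [lie_swap, lie_add_left, lie_swap Y, lie_swap Z]; abel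

theorem lie_zero_right (X : V) : lie F V X 0 = 0 := by
  simpa using lie_add_right (F := F) X 0 0

theorem lie_neg_right (X Y : V) : lie F V X (-Y) = -lie F V X Y := by
  have h := lie_add_right (F := F) X Y (-Y)
  rw [add_neg_cancel, lie_zero_right] at h
  exact (neg_eq_of_add_eq_zero_right h.symm).symm

theorem lie_sub_right (X Y Z : V) : lie F V X (Y - Z) = lie F V X Y - lie F V X Z := by
  rw [sub_eq_add_neg, lie_add_right, lie_neg_right, sub_eq_add_neg]

theorem lie_smul_right (X : V) (f : F) (Y : V) :
    lie F V X (f • Y) = f • lie F V X Y + der F V X f • Y :=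
  SmoothSetting.bracket_smulRight X f Y

theorem lie_jacobi (X Y Z : V) :
    lie F V (lie F V X Y) Z = lie F V X (lie F V Y Z) - lie F V Y (lie F V X Z) := by
  have h : lie F V X (lie F V Y Z) + lie F V Y (lie F V Z X) + lie F V Z (lie F V X Y) = 0 :=
    SmoothSetting.jacobi X Y Z
  rw [lie_swap Z X, lie_neg_right, lie_swap Z] at h
  linear_combination (norm := module) -h

/-- A function is zero if twice it is zero. -/
theorem eq_zero_of_add_self {x : F} (h : x + x = 0) : x = 0 := by
  have h2 : algebraMap ℝ F 2⁻¹ * 2 = 1 := by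
    rw [← map_ofNat (algebraMap ℝ F) 2, ← map_mul]; norm_num
  linear_combination algebraMap ℝ F 2⁻¹ * h - x * h2

theorem eq_zero_of_const_mul {r : ℝ} (hr : r ≠ 0) {x : F} (h : algebraMap ℝ F r * x = 0) :
    x = 0 := by
  have h2 : algebraMap ℝ F r⁻¹ * algebraMap ℝ F r = 1 := by
    rw [← map_mul, inv_mul_cancel₀ hr, map_one]
  linear_combination algebraMap ℝ F r⁻¹ * h - x * h2

/-- The exterior differential of a 1-form, without normalizing factor. -/
def extDer (θ : V → F) (X Y : V) : F :=
  der F V X (θ Y) - der F V Y (θ X) - θ (lie F V X Y)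

theorem two_smul_dOne (θ : V → F) (X Y : V) : (2 : ℝ) • dOne F V θ X Y = extDer θ X Y := by
  rw [dOne, smul_smul, extDer]; norm_num

theorem dOne_eq (θ : V → F) (X Y : V) : dOne F V θ X Y = (2 : ℝ)⁻¹ • extDer θ X Y := rfl

theorem dOne_eq_zero_iff (θ : V → F) (X Y : V) : dOne F V θ X Y = 0 ↔ extDer θ X Y = 0 := by
  constructor <;> intro h
  · rw [← two_smul_dOne, h, smul_zero]
  · rw [dOne_eq, h, smul_zero]

/-- The exterior differential of a 2-form, without normalizing factor. -/
def extDerTwo (ω : V → V → F) (X Y Z : V) : F :=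
  der F V X (ω Y Z) + der F V Y (ω Z X) + der F V Z (ω X Y)
    - ω (lie F V X Y) Z - ω (lie F V Y Z) X - ω (lie F V Z X) Y

theorem IsClosedTwo.extDerTwo_eq_zero {ω : V → V → F} (h : ∀ X Y Z, dTwo F V ω X Y Z = 0)
    (X Y Z : V) : extDerTwo ω X Y Z = 0 := by
  have h1 : (3 : ℝ) • dTwo F V ω X Y Z = extDerTwo ω X Y Z := by
    rw [dTwo, smul_smul, extDerTwo]; norm_num
  rw [← h1, h, smul_zero]

theorem extDer_swap {θ : V → F} (hneg : ∀ X, θ (-X) = -θ X) (X Y : V) :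
    extDer θ X Y = -extDer θ Y X := by
  rw [extDer, extDer, lie_swap X Y, hneg]; ring

theorem extDerTwo_extDer {θ : V → F} (hadd : ∀ X Y, θ (X + Y) = θ X + θ Y) (X Y Z : V) :
    extDerTwo (extDer θ) X Y Z = 0 := by
  have h0 : θ 0 = 0 := by simpa using hadd 0 0
  have hj : lie F V (lie F V X Y) Z + lie F V (lie F V Y Z) X + lie F V (lie F V Z X) Y = 0 := by
    rw [lie_jacobi, lie_swap (lie F V Y Z) X, lie_swap (lie F V Z X), lie_swap Z X,
      lie_neg_right]; abel
  have h1 := congrArg θ hj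
  rw [hadd, hadd, h0] at h1
  simp only [extDerTwo, extDer, der_sub, der_lie]
  linear_combination h1

end calculus

section almostContact

variable {F V : Type} [CommRing F] [Algebra ℝ F] [AddCommGroup V] [Module F V]
  [SmoothSetting F V] [ACM3 F V]

theorem gm_comm (X Y : V) : gm F V X Y = gm F V Y X := ACM3.g_symm X Y

theorem gm_add_left (X Y Z : V) : gm F V (X + Y) Z = gm F V X Z + gm F V Y Z :=
  ACM3.g_addLeft X Y Z

theorem gm_smul_left (f : F) (X Y : V) : gm F V (f • X) Y = f * gm F V X Y :=
  ACM3.g_smulLeft f X Y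

theorem gm_add_right (X Y Z : V) : gm F V X (Y + Z) = gm F V X Y + gm F V X Z := by
  rw [gm_comm, gm_add_left, gm_comm Y, gm_comm Z]

theorem gm_smul_right (f : F) (X Y : V) : gm F V X (f • Y) = f * gm F V X Y := by
  rw [gm_comm, gm_smul_left, gm_comm]

theorem gm_neg_left (X Y : V) : gm F V (-X) Y = -gm F V X Y := by
  rw [← neg_one_smul F, gm_smul_left]; ring

theorem gm_neg_right (X Y : V) : gm F V X (-Y) = -gm F V X Y := by
  rw [gm_comm, gm_neg_left, gm_comm]

theorem gm_sub_left (X Y Z : V) : gm F V (X - Y) Z = gm F V X Z - gm F V Y Z := by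
  rw [sub_eq_add_neg, gm_add_left, gm_neg_left]; ring

theorem gm_sub_right (X Y Z : V) : gm F V X (Y - Z) = gm F V X Y - gm F V X Z := by
  rw [gm_comm, gm_sub_left, gm_comm Y, gm_comm Z]

theorem gm_zero_left (X : V) : gm F V 0 X = 0 := by
  simpa using gm_add_left (F := F) 0 0 X

theorem gm_zero_right (X : V) : gm F V X 0 = 0 := by
  rw [gm_comm, gm_zero_left]

theorem eq_zero_of_gm {X : V} (h : ∀ Y, gm F V Y X = 0) : X = 0 :=
  ACM3.g_nondeg (F := F) X fun Y => (gm_comm X Y).trans (h Y)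

theorem eq_of_gm {X Y : V} (h : ∀ Z, gm F V Z X = gm F V Z Y) : X = Y :=
  sub_eq_zero.1 <| eq_zero_of_gm (F := F) fun Z => by rw [gm_sub_right, h, sub_self]

theorem ph_add (a : Fin 3) (X Y : V) : ph F V a (X + Y) = ph F V a X + ph F V a Y :=
  ACM3.phi_add a X Y

theorem ph_smul (a : Fin 3) (f : F) (X : V) : ph F V a (f • X) = f • ph F V a X :=
  ACM3.phi_smul a f X

theorem ph_neg (a : Fin 3) (X : V) : ph F V a (-X) = -ph F V a X := by
  rw [← neg_one_smul F, ph_smul, neg_one_smul]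

theorem ph_sub (a : Fin 3) (X Y : V) : ph F V a (X - Y) = ph F V a X - ph F V a Y := by
  rw [sub_eq_add_neg, ph_add, ph_neg, sub_eq_add_neg]

theorem ph_zero (a : Fin 3) : ph F V a 0 = 0 := by
  simpa using ph_add (F := F) a (0 : V) 0

theorem et_eq (a : Fin 3) (X : V) : et F V a X = gm F V X (rxi F V a) := ACM3.eta_eq a X

theorem et_add (a : Fin 3) (X Y : V) : et F V a (X + Y) = et F V a X + et F V a Y := by
  simp only [et_eq, gm_add_left]

theorem et_smul (a : Fin 3) (f : F) (X : V) : et F V a (f • X) = f * et F V a X := by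
  simp only [et_eq, gm_smul_left]

theorem et_neg (a : Fin 3) (X : V) : et F V a (-X) = -et F V a X := by
  simp only [et_eq, gm_neg_left]

theorem et_sub (a : Fin 3) (X Y : V) : et F V a (X - Y) = et F V a X - et F V a Y := by
  simp only [et_eq, gm_sub_left]

theorem et_zero (a : Fin 3) : et F V a 0 = 0 := by
  simp only [et_eq, gm_zero_left]

theorem gm_rxi_left (a : Fin 3) (X : V) : gm F V (rxi F V a) X = et F V a X := by
  rw [gm_comm, et_eq]

theorem ph_ph (a : Fin 3) (X : V) :
    ph F V a (ph F V a X) = -X + et F V a X • rxi F V a := ACM3.acm_sq a X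

theorem et_rxi (a : Fin 3) : et F V a (rxi F V a) = 1 := ACM3.eta_xi a

theorem gm_ph_ph (a : Fin 3) (X Y : V) :
    gm F V (ph F V a X) (ph F V a Y) = gm F V X Y - et F V a X * et F V a Y :=
  ACM3.compat a X Y

theorem Cyclic.rotate {a b c : Fin 3} (h : Cyclic a b c) : Cyclic b c a := by
  revert h; unfold Cyclic; revert a b c; decide

theorem cyclic_add (a : Fin 3) : Cyclic a (a + 1) (a + 2) := by
  unfold Cyclic; revert a; decide

theorem Cyclic.eq_add {a b c : Fin 3} (h : Cyclic a b c) : b = a + 1 ∧ c = a + 2 := by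
  revert h; unfold Cyclic; revert a b c; decide

theorem ph_eq_ph_ph {a b c : Fin 3} (h : Cyclic a b c) (X : V) :
    ph F V c X = ph F V a (ph F V b X) - et F V b X • rxi F V a := ACM3.quat_phi a b c h X

theorem ph_eq_neg_ph_ph {a b c : Fin 3} (h : Cyclic a b c) (X : V) :
    ph F V c X = -ph F V b (ph F V a X) + et F V a X • rxi F V b := ACM3.quat_phi' a b c h X

theorem ph_rxi {a b c : Fin 3} (h : Cyclic a b c) : ph F V a (rxi F V b) = rxi F V c :=
  (ACM3.quat_xi a b c h).symm

theorem ph_rxi' {a b c : Fin 3} (h : Cyclic a b c) : ph F V b (rxi F V a) = -rxi F V c := by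
  have h1 : rxi F V c = -ph F V b (rxi F V a) := ACM3.quat_xi' a b c h
  rw [h1, neg_neg]

theorem et_ph {a b c : Fin 3} (h : Cyclic a b c) (X : V) : et F V a (ph F V b X) = et F V c X :=
  (ACM3.quat_eta a b c h X).symm

theorem et_ph' {a b c : Fin 3} (h : Cyclic a b c) (X : V) : et F V b (ph F V a X) = -et F V c X := by
  have h1 : et F V c X = -et F V b (ph F V a X) := ACM3.quat_eta' a b c h X
  rw [h1, neg_neg]

theorem et_rxi_of_cyclic {a b c : Fin 3} (h : Cyclic a b c) : et F V b (rxi F V a) = 0 := by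
  have h1 : et F V b (rxi F V a) = -et F V a (rxi F V b) := by
    rw [← ph_rxi h.rotate.rotate, et_ph' h.rotate.rotate, neg_neg]
  have h2 : et F V a (rxi F V b) = et F V b (rxi F V a) := by
    rw [et_eq, et_eq, gm_comm]
  exact eq_zero_of_add_self (by linear_combination h1 - h2)

theorem et_rxi_of_cyclic' {a b c : Fin 3} (h : Cyclic a b c) : et F V a (rxi F V b) = 0 := by
  rw [et_eq, gm_rxi_left, et_rxi_of_cyclic h]

theorem et_ph_eq_et_ph {a b c : Fin 3} (h : Cyclic a b c) (X : V) :
    et F V c (ph F V c X) = et F V b (ph F V b X) := by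
  rw [ph_eq_ph_ph h, et_sub, et_smul, et_ph h.rotate.rotate,
    et_rxi_of_cyclic' h.rotate.rotate]
  ring

theorem ph_rxi_self (a : Fin 3) : ph F V a (rxi F V a) = 0 := by
  have h := cyclic_add a
  have h1 : et F V a (ph F V a (rxi F V a)) = 0 := by
    rw [et_ph_eq_et_ph h.rotate, ph_rxi h.rotate.rotate, et_rxi_of_cyclic h.rotate]
  have h2 := ph_ph (F := F) a (ph F V a (rxi F V a))
  rw [h1, ph_ph a (rxi F V a), et_rxi, one_smul, neg_add_cancel, ph_zero, zero_smul, add_zero] at h2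
  exact neg_eq_zero.1 h2.symm

theorem et_ph_self (a : Fin 3) (X : V) : et F V a (ph F V a X) = 0 := by
  have h1 := ph_ph (F := F) a (ph F V a X)
  rw [ph_ph a X, ph_add, ph_neg, ph_smul, ph_rxi_self, smul_zero, add_zero, left_eq_add] at h1
  have h2 := congrArg (et F V a) h1
  rwa [et_smul, et_rxi, mul_one, et_zero] at h2

theorem gm_ph_left (a : Fin 3) (X Y : V) :
    gm F V (ph F V a X) Y = -gm F V X (ph F V a Y) := by
  have h := gm_ph_ph (F := F) a X (ph F V a Y)
  rw [ph_ph, gm_add_right, gm_neg_right, gm_smul_right, ← et_eq, et_ph_self, et_ph_self] at h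
  linear_combination -h

theorem Cyclic.cases {a b c : Fin 3} (h : Cyclic a b c) (d : Fin 3) : d = a ∨ d = b ∨ d = c := by
  revert h; unfold Cyclic; revert a b c d; decide

theorem Horiz.ph {X : V} (hX : Horiz F V X) (a : Fin 3) : Horiz F V (ph F V a X) := by
  intro d
  have h := cyclic_add a
  rcases h.cases d with rfl | rfl | rfl
  · exact et_ph_self _ X
  · rw [et_ph' h, hX, neg_zero]
  · rw [et_ph h.rotate.rotate, hX]

theorem Horiz.ph_ph {X : V} (hX : Horiz F V X) (a : Fin 3) :
    QS3.ph F V a (QS3.ph F V a X) = -X := by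
  rw [QS3.ph_ph, hX, zero_smul, add_zero]

theorem Horiz.ph_ph_of_cyclic {X : V} (hX : Horiz F V X) {a b c : Fin 3} (h : Cyclic a b c) :
    QS3.ph F V a (QS3.ph F V b X) = QS3.ph F V c X := by
  rw [ph_eq_ph_ph h, hX, zero_smul, sub_zero]

theorem Horiz.ph_ph_of_cyclic' {X : V} (hX : Horiz F V X) {a b c : Fin 3} (h : Cyclic a b c) :
    QS3.ph F V b (QS3.ph F V a X) = -QS3.ph F V c X := by
  rw [ph_eq_neg_ph_ph h, hX, zero_smul, add_zero, neg_neg]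

theorem Horiz.smul {X : V} (hX : Horiz F V X) (f : F) : Horiz F V (f • X) :=
  fun d => by rw [et_smul, hX, mul_zero]

theorem Horiz.sub {X Y : V} (hX : Horiz F V X) (hY : Horiz F V Y) : Horiz F V (X - Y) :=
  fun d => by rw [et_sub, hX, hY, sub_zero]

end almostContact

section reeb

variable {F V : Type} [CommRing F] [Algebra ℝ F] [AddCommGroup V] [Module F V]
  [SmoothSetting F V]

theorem lie_self (X : V) : lie F V X X = 0 := by
  have h : (2 : F) • lie F V X X = 0 := by
    rw [two_smul, ← eq_neg_iff_add_eq_zero]; exact lie_swap X X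
  have h2 : algebraMap ℝ F 2⁻¹ * 2 = 1 := by
    rw [← map_ofNat (algebraMap ℝ F) 2, ← map_mul]; norm_num
  rw [← one_smul F (lie F V X X), ← h2, mul_smul, h, smul_zero]

theorem lie_const_smul_left (r : ℝ) (X Y : V) :
    lie F V (algebraMap ℝ F r • X) Y = algebraMap ℝ F r • lie F V X Y := by
  rw [lie_swap, lie_smul_right, der_algebraMap, zero_smul, add_zero, lie_swap X, smul_neg]

variable [ACM3 F V]

/-- The Lie derivative of `φ_b` along `ξ_a`. -/
def lieDerPh (a b : Fin 3) (X : V) : V :=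
  lie F V (rxi F V a) (ph F V b X) - ph F V b (lie F V (rxi F V a) X)

theorem lie_rxi_ph_eq (a b : Fin 3) (X : V) :
    lie F V (rxi F V a) (ph F V b X)
      = lieDerPh (F := F) a b X + ph F V b (lie F V (rxi F V a) X) := by
  rw [lieDerPh, sub_add_cancel]

/-- The skew-symmetric endomorphism representing the 2-form `2 dη_a`. -/
def dEtaEnd (a : Fin 3) (X : V) : V := lieDerPh (F := F) (a + 1) (a + 2) X

theorem Cyclic.dEtaEnd_eq {a b c : Fin 3} (h : Cyclic a b c) (X : V) :
    dEtaEnd (F := F) a X = lieDerPh (F := F) b c X := by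
  obtain ⟨rfl, rfl⟩ := h.eq_add
  rfl

theorem Phi_swap (a : Fin 3) (X Y : V) : Phi F V a X Y = -Phi F V a Y X := by
  rw [Phi, Phi, gm_comm X, gm_ph_left]

theorem extDer_et_swap (a : Fin 3) (X Y : V) :
    extDer (et F V a) X Y = -extDer (et F V a) Y X := extDer_swap (et_neg a) X Y

theorem et_rxi_eq_ite (a b : Fin 3) : et F V a (rxi F V b) = if a = b then 1 else 0 := by
  have h := cyclic_add a
  split_ifs with hab
  · rw [hab, et_rxi]
  · rcases h.cases b with rfl | hb | hb
    · exact absurd rfl hab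
    · rw [hb, et_rxi_of_cyclic' h]
    · rw [hb, et_rxi_of_cyclic h.rotate.rotate]

theorem InE4l.sub {X Y : V} (hX : InE4l F V X) (hY : InE4l F V Y) : InE4l F V (X - Y) :=
  ⟨hX.1.sub hY.1, fun Z hZ => by rw [gm_sub_left, hX.2 Z hZ, hY.2 Z hZ, sub_zero]⟩

theorem InE4l.smul {X : V} (hX : InE4l F V X) (f : F) : InE4l F V (f • X) :=
  ⟨hX.1.smul f, fun Z hZ => by rw [gm_smul_left, hX.2 Z hZ, mul_zero]⟩

theorem InE4l3.gm_eq_zero {W X : V} (hW : InE4l3 F V W) (hX : InE4m F V X) :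
    gm F V W X = 0 := by
  obtain ⟨Y, Z, hY, ⟨p, q, r, rfl⟩, rfl⟩ := hW
  simp only [gm_add_left, gm_smul_left, gm_rxi_left, hX.1 _, hY.2 X hX]
  ring

theorem der_et_rxi (X : V) (a b : Fin 3) : der F V X (et F V a (rxi F V b)) = 0 := by
  rw [et_rxi_eq_ite]
  split_ifs
  · exact der_one X
  · exact der_zero X

variable [ThreeQS F V]

theorem normality (a : Fin 3) (X Y : V) :
    ph F V a (ph F V a (lie F V X Y)) + lie F V (ph F V a X) (ph F V a Y)
      - ph F V a (lie F V (ph F V a X) Y) - ph F V a (lie F V X (ph F V a Y))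
      + extDer (et F V a) X Y • rxi F V a = 0 := by
  have h := (ThreeQS.qs (F := F) (V := V) a).1 X Y
  rwa [NOne, two_smul_dOne, Nij] at h

theorem extDerTwo_Phi (a : Fin 3) (X Y Z : V) : extDerTwo (Phi F V a) X Y Z = 0 :=
  IsClosedTwo.extDerTwo_eq_zero (ThreeQS.qs (F := F) (V := V) a).2 X Y Z

theorem extDer_et_rxi_self (a : Fin 3) (X : V) :
    extDer (et F V a) X (rxi F V a) = 0 := by
  have h := congrArg (et F V a) (normality (F := F) a X (rxi F V a))
  simpa only [ph_rxi_self, lie_zero_right, ph_zero, et_add, et_sub, et_smul, et_ph_self, et_zero,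
    et_rxi, mul_one, add_zero, zero_add, sub_zero] using h

theorem extDer_et_ph_ph (a : Fin 3) (X Y : V) :
    extDer (et F V a) (ph F V a X) (ph F V a Y) = extDer (et F V a) X Y := by
  have h := congrArg (et F V a) (normality (F := F) a X Y)
  simp only [et_add, et_sub, et_smul, et_ph_self, et_zero, et_rxi] at h
  rw [extDer, et_ph_self, et_ph_self, der_zero, der_zero]
  linear_combination -h

theorem et_lie_rxi_self (a : Fin 3) (X : V) :
    et F V a (lie F V (rxi F V a) X) = der F V (rxi F V a) (et F V a X) := by
  have h := extDer_et_rxi_self (F := F) a X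
  rw [extDer, et_rxi, der_one, lie_swap, et_neg] at h
  linear_combination h

theorem lie_rxi_ph_self (a : Fin 3) (X : V) :
    lie F V (rxi F V a) (ph F V a X) = ph F V a (lie F V (rxi F V a) X) := by
  have h0 : et F V a (lie F V (rxi F V a) (ph F V a X)) = 0 := by
    rw [et_lie_rxi_self, et_ph_self, der_zero]
  have h := congrArg (ph F V a) (normality (F := F) a X (rxi F V a))
  rw [extDer_et_rxi_self, ph_rxi_self, lie_zero_right, lie_zero_right, ph_zero, zero_smul,
    lie_swap X, lie_swap (ph F V a X)] at h
  simp only [ph_add, ph_sub, ph_neg, ph_zero, ph_ph, h0, ph_smul, ph_rxi_self] at h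
  linear_combination (norm := module) -h

theorem lieDerPh_self (a : Fin 3) (X : V) : lieDerPh (F := F) a a X = 0 := by
  rw [lieDerPh, lie_rxi_ph_self, sub_self]

theorem der_rxi_Phi (a b : Fin 3) (X Y : V) :
    der F V (rxi F V a) (Phi F V b X Y)
      = Phi F V b (lie F V (rxi F V a) X) Y + Phi F V b X (lie F V (rxi F V a) Y)
        + extDer (fun Z => et F V a (ph F V b Z)) X Y := by
  have h := extDerTwo_Phi (F := F) b (rxi F V a) X Y
  have h1 : ∀ Z, Phi F V b (rxi F V a) Z = et F V a (ph F V b Z) := fun Z => by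
    rw [Phi, gm_rxi_left]
  rw [extDerTwo, Phi_swap b Y, Phi_swap b (lie F V X Y), Phi_swap b (lie F V Y _),
    lie_swap Y, h1, h1, h1, der_neg] at h
  rw [extDer]
  have h2 : Phi F V b X (-lie F V (rxi F V a) Y) = -Phi F V b X (lie F V (rxi F V a) Y) := by
    rw [Phi, Phi, ph_neg, gm_neg_right]
  rw [h2] at h
  linear_combination h

/-- The Reeb vector fields are Killing. -/
theorem der_rxi_gm (a : Fin 3) (X Y : V) :
    der F V (rxi F V a) (gm F V X Y)
      = gm F V (lie F V (rxi F V a) X) Y + gm F V X (lie F V (rxi F V a) Y) := by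
  have h := der_rxi_Phi (F := F) a a X (ph F V a Y)
  have h1 : extDer (fun Z => et F V a (ph F V a Z)) X (ph F V a Y) = 0 := by
    simp only [extDer, et_ph_self, der_zero, sub_zero]
  rw [h1] at h
  simp only [Phi, lie_rxi_ph_self, ph_ph, gm_add_right, gm_neg_right, gm_smul_right, ← et_eq,
    der_add, der_neg, der_mul, et_lie_rxi_self] at h
  linear_combination -h

theorem extDer_et_eq_lieDerPh {a b c : Fin 3} (h : Cyclic a b c) (X Y : V) :
    extDer (et F V a) X Y = gm F V X (lieDerPh (F := F) b c Y) := by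
  have h1 := der_rxi_Phi (F := F) b c X Y
  simp only [et_ph h.rotate] at h1
  rw [Phi, der_rxi_gm, Phi, Phi] at h1
  rw [lieDerPh, gm_sub_right]
  linear_combination -h1

theorem extDer_et_eq_neg_lieDerPh {a b c : Fin 3} (h : Cyclic a b c) (X Y : V) :
    extDer (et F V a) X Y = -gm F V X (lieDerPh (F := F) c b Y) := by
  have h1 := der_rxi_Phi (F := F) c b X Y
  simp only [et_ph' h.rotate] at h1
  rw [Phi, der_rxi_gm, Phi, Phi] at h1
  have h2 : extDer (fun Z => -et F V a Z) X Y = -extDer (et F V a) X Y := by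
    simp only [extDer, der_neg]; ring
  rw [lieDerPh, gm_sub_right]
  linear_combination h1 + h2

theorem lieDerPh_swap {a b c : Fin 3} (h : Cyclic a b c) (X : V) :
    lieDerPh (F := F) c b X = -lieDerPh (F := F) b c X :=
  eq_of_gm (F := F) fun Z => by
    rw [gm_neg_right, ← extDer_et_eq_lieDerPh h, extDer_et_eq_neg_lieDerPh h, neg_neg]

theorem extDer_et_eq (a : Fin 3) (X Y : V) :
    extDer (et F V a) X Y = gm F V X (dEtaEnd (F := F) a Y) :=
  extDer_et_eq_lieDerPh (cyclic_add a) X Y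

theorem gm_dEtaEnd_right (a : Fin 3) (X Y : V) :
    gm F V X (dEtaEnd (F := F) a Y) = -gm F V (dEtaEnd (F := F) a X) Y := by
  rw [← extDer_et_eq, extDer_et_swap, extDer_et_eq, gm_comm]

theorem dEtaEnd_add (a : Fin 3) (X Y : V) :
    dEtaEnd (F := F) a (X + Y) = dEtaEnd (F := F) a X + dEtaEnd (F := F) a Y :=
  eq_of_gm (F := F) fun Z => by
    rw [gm_dEtaEnd_right, gm_add_right, gm_add_right, gm_dEtaEnd_right, gm_dEtaEnd_right a Z]; ring

theorem dEtaEnd_smul (a : Fin 3) (f : F) (X : V) :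
    dEtaEnd (F := F) a (f • X) = f • dEtaEnd (F := F) a X :=
  eq_of_gm (F := F) fun Z => by
    rw [gm_dEtaEnd_right, gm_smul_right, gm_smul_right, gm_dEtaEnd_right]; ring

theorem dEtaEnd_sub (a : Fin 3) (X Y : V) :
    dEtaEnd (F := F) a (X - Y) = dEtaEnd (F := F) a X - dEtaEnd (F := F) a Y := by
  rw [sub_eq_add_neg, dEtaEnd_add, ← neg_one_smul F Y, dEtaEnd_smul, neg_one_smul,
    sub_eq_add_neg]

theorem lie_rxi_rxi {a b c : Fin 3} (h : Cyclic a b c) :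
    lie F V (rxi F V a) (rxi F V b) = algebraMap ℝ F (cc F V) • rxi F V c :=
  ThreeQS.reeb_bracket a b c h

theorem der_rxi_et {a b c : Fin 3} (h : Cyclic a b c) (X : V) :
    der F V (rxi F V a) (et F V b X)
      = et F V b (lie F V (rxi F V a) X) + algebraMap ℝ F (cc F V) * et F V c X := by
  rw [et_eq, der_rxi_gm, lie_rxi_rxi h, gm_smul_right, ← et_eq, ← et_eq]

theorem der_rxi_et' {a b c : Fin 3} (h : Cyclic a b c) (X : V) :
    der F V (rxi F V b) (et F V a X)
      = et F V a (lie F V (rxi F V b) X) - algebraMap ℝ F (cc F V) * et F V c X := by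
  rw [et_eq, der_rxi_gm, lie_swap (rxi F V b) (rxi F V a), lie_rxi_rxi h, gm_neg_right,
    gm_smul_right, ← et_eq, ← et_eq, ← sub_eq_add_neg]

theorem Horiz.lie_rxi {X : V} (hX : Horiz F V X) (a : Fin 3) :
    Horiz F V (lie F V (rxi F V a) X) := by
  intro d
  have h := cyclic_add a
  rcases h.cases d with rfl | rfl | rfl
  · rw [et_lie_rxi_self, hX, der_zero]
  · have h1 := der_rxi_et (F := F) h X
    rw [hX, hX, der_zero] at h1
    linear_combination -h1
  · have h1 := der_rxi_et' (F := F) h.rotate.rotate X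
    rw [hX, hX, der_zero] at h1
    linear_combination -h1

theorem et_dEtaEnd (a d : Fin 3) (X : V) :
    et F V d (dEtaEnd (F := F) a X)
      = der F V (rxi F V d) (et F V a X) - et F V a (lie F V (rxi F V d) X) := by
  rw [← gm_rxi_left, ← extDer_et_eq, extDer, der_et_rxi, sub_zero]

theorem Horiz.dEtaEnd {X : V} (hX : Horiz F V X) (a : Fin 3) :
    Horiz F V (QS3.dEtaEnd (F := F) a X) := fun d => by
  rw [et_dEtaEnd, hX, hX.lie_rxi d, der_zero, sub_zero]

theorem lieDerPh_eq_ph_lieDerPh {a b c : Fin 3} (h : Cyclic a b c) (X : V) :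
    lieDerPh (F := F) a c X = ph F V a (lieDerPh (F := F) a b X)
      - (algebraMap ℝ F (cc F V) * et F V c X) • rxi F V a := by
  rw [lieDerPh, ph_eq_ph_ph h, ph_eq_ph_ph h, lie_sub_right, lie_rxi_ph_self, lie_smul_right,
    lie_self, der_rxi_et h, lieDerPh, ph_sub]
  module

theorem dEtaEnd_eq_neg_ph {a b c : Fin 3} (h : Cyclic a b c) (X : V) :
    dEtaEnd (F := F) b X = -ph F V a (dEtaEnd (F := F) c X)
      + (algebraMap ℝ F (cc F V) * et F V c X) • rxi F V a := by
  rw [h.rotate.dEtaEnd_eq, h.rotate.rotate.dEtaEnd_eq, ← neg_neg (lieDerPh c a X),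
    ← lieDerPh_swap h.rotate, lieDerPh_eq_ph_lieDerPh h]
  module

theorem Horiz.dEtaEnd_eq_neg_ph {X : V} (hX : Horiz F V X) {a b c : Fin 3} (h : Cyclic a b c) :
    QS3.dEtaEnd (F := F) b X = -QS3.ph F V a (QS3.dEtaEnd (F := F) c X) := by
  rw [QS3.dEtaEnd_eq_neg_ph h, hX, mul_zero, zero_smul, add_zero]

theorem Horiz.dEtaEnd_eq_ph {X : V} (hX : Horiz F V X) {a b c : Fin 3} (h : Cyclic a b c) :
    QS3.dEtaEnd (F := F) b X = QS3.ph F V c (QS3.dEtaEnd (F := F) a X) := by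
  rw [hX.dEtaEnd_eq_neg_ph h.rotate.rotate, ph_neg, (hX.dEtaEnd b).ph_ph, neg_neg]

theorem lie_rxi_lie_rxi {a b c : Fin 3} (h : Cyclic a b c) (X : V) :
    lie F V (rxi F V a) (lie F V (rxi F V b) X)
      = lie F V (rxi F V b) (lie F V (rxi F V a) X)
        + algebraMap ℝ F (cc F V) • lie F V (rxi F V c) X := by
  rw [← lie_const_smul_left, ← lie_rxi_rxi h, lie_jacobi]
  abel

theorem lie_rxi_dEtaEnd {a b c : Fin 3} (h : Cyclic a b c) (X : V) :
    lie F V (rxi F V a) (dEtaEnd (F := F) b X)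
      = dEtaEnd (F := F) b (lie F V (rxi F V a) X)
        + algebraMap ℝ F (cc F V) • dEtaEnd (F := F) c X := by
  have h1 : ∀ Z : V, lie F V (rxi F V a) (lie F V (rxi F V c) Z)
      = lie F V (rxi F V c) (lie F V (rxi F V a) Z)
        - algebraMap ℝ F (cc F V) • lie F V (rxi F V b) Z := fun Z => by
    rw [lie_rxi_lie_rxi h.rotate.rotate, add_sub_cancel_right]
  rw [h.rotate.dEtaEnd_eq, h.rotate.dEtaEnd_eq, h.rotate.rotate.dEtaEnd_eq,
    ← neg_neg (lieDerPh a b X), ← lieDerPh_swap h.rotate.rotate, lieDerPh, lieDerPh, lieDerPh,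
    lie_sub_right, h1, lie_rxi_ph_self, lie_rxi_ph_self, h1, ph_sub, ph_smul]
  module

theorem lie_rxi_dEtaEnd_self (a : Fin 3) (X : V) :
    lie F V (rxi F V a) (dEtaEnd (F := F) a X) = dEtaEnd (F := F) a (lie F V (rxi F V a) X) := by
  have key : ∀ {a b c : Fin 3}, Cyclic a b c →
      lie F V (rxi F V a) (dEtaEnd (F := F) a X) - dEtaEnd (F := F) a (lie F V (rxi F V a) X)
        = -(lie F V (rxi F V b) (dEtaEnd (F := F) b X)
          - dEtaEnd (F := F) b (lie F V (rxi F V b) X)) := by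
    intro a b c h
    have h2 := lieDerPh_self (F := F) c X
    rw [lieDerPh] at h2
    have h3 : ∀ Z : V, lieDerPh (F := F) c a Z = -lieDerPh (F := F) a c Z := fun Z => by
      rw [lieDerPh_swap h.rotate, neg_neg]
    rw [h.dEtaEnd_eq, h.dEtaEnd_eq, h.rotate.dEtaEnd_eq, h.rotate.dEtaEnd_eq, h3, h3, lieDerPh,
      lieDerPh, lieDerPh, lieDerPh, lie_neg_right,
      lie_sub_right, lie_sub_right, lie_rxi_lie_rxi h, lie_rxi_lie_rxi h, ph_add, ph_smul]
    linear_combination (norm := module) algebraMap ℝ F (cc F V) • h2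
  have h := cyclic_add a
  have h1 := key h
  rw [key h.rotate, neg_neg, key h.rotate.rotate] at h1
  refine eq_of_gm (F := F) fun Z => ?_
  have h2 := congrArg (gm F V Z) h1
  rw [gm_neg_right, gm_sub_right] at h2
  have h3 := eq_zero_of_add_self (F := F)
    (x := gm F V Z (lie F V (rxi F V a) (dEtaEnd (F := F) a X))
      - gm F V Z (dEtaEnd (F := F) a (lie F V (rxi F V a) X)))
    (by linear_combination h2)
  exact sub_eq_zero.1 h3

theorem Horiz.dEtaEnd_dEtaEnd {X : V} (hX : Horiz F V X) {a b c : Fin 3} (h : Cyclic a b c) :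
    QS3.dEtaEnd (F := F) b (QS3.dEtaEnd (F := F) a X)
      = -(algebraMap ℝ F (cc F V) • QS3.dEtaEnd (F := F) c X) := by
  have h1 := lie_rxi_dEtaEnd (F := F) h X
  rw [hX.dEtaEnd_eq_ph h, lie_rxi_ph_eq, lie_rxi_dEtaEnd_self, (hX.lie_rxi a).dEtaEnd_eq_ph h,
    lieDerPh_swap h.rotate, ← h.rotate.dEtaEnd_eq] at h1
  linear_combination (norm := module) -h1

theorem Horiz.dEtaEnd_sq {X : V} (hX : Horiz F V X) (a : Fin 3) :
    QS3.dEtaEnd (F := F) a (QS3.dEtaEnd (F := F) a X)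
      = algebraMap ℝ F (cc F V) • QS3.ph F V a (QS3.dEtaEnd (F := F) a X) := by
  have h := cyclic_add a
  have h1 := hX.dEtaEnd_dEtaEnd h
  rw [(hX.dEtaEnd a).dEtaEnd_eq_ph h, hX.dEtaEnd_eq_neg_ph h.rotate] at h1
  have h2 := congrArg (QS3.ph F V (a + 2)) h1
  rw [((hX.dEtaEnd a).dEtaEnd a).ph_ph, ph_neg, ph_smul, ph_neg,
    (hX.dEtaEnd a).ph_ph_of_cyclic' h.rotate] at h2
  linear_combination (norm := module) -h2

theorem Horiz.dEtaEnd_ph {X : V} (hX : Horiz F V X) (a : Fin 3) :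
    QS3.dEtaEnd (F := F) a (QS3.ph F V a X) = QS3.ph F V a (QS3.dEtaEnd (F := F) a X) := by
  refine eq_of_gm (F := F) fun Z => ?_
  have h1 := extDer_et_ph_ph (F := F) a Z (QS3.ph F V a X)
  rw [hX.ph_ph, extDer_et_eq, extDer_et_eq, ← neg_one_smul F X, dEtaEnd_smul, gm_smul_right,
    gm_ph_left] at h1
  linear_combination -h1

theorem InE4m.dEtaEnd_eq_zero {X : V} (hX : InE4m F V X) (a : Fin 3) :
    dEtaEnd (F := F) a X = 0 :=
  eq_zero_of_gm (F := F) fun Z => by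
    rw [← extDer_et_eq, extDer_et_swap, (dOne_eq_zero_iff _ _ _).1 (hX.2 a Z), neg_zero]

theorem inE4m_of_dEtaEnd {X : V} (hX : Horiz F V X) (h : ∀ a, dEtaEnd (F := F) a X = 0) :
    InE4m F V X :=
  ⟨hX, fun a Y => by
    rw [dOne_eq_zero_iff, extDer_et_swap, extDer_et_eq, h, gm_zero_right, neg_zero]⟩

theorem InE4l.dEtaEnd {X : V} (hX : InE4l F V X) (a : Fin 3) :
    InE4l F V (QS3.dEtaEnd (F := F) a X) :=
  ⟨hX.1.dEtaEnd a, fun Z hZ => by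
    rw [← neg_eq_zero, ← gm_dEtaEnd_right, hZ.dEtaEnd_eq_zero, gm_zero_right]⟩

theorem exists_inE4l3_add_inE4m (X : V) :
    ∃ Y Z, InE4l3 F V Y ∧ InE4m F V Z ∧ X = Y + Z := by
  have hv : InVert F V (X - horComp F V X) :=
    ⟨et F V 0 X, et F V 1 X, et F V 2 X, by rw [horComp, Fin.sum_univ_three]; abel⟩
  have hh : Horiz F V (horComp F V X) := fun d => by
    rw [horComp, Fin.sum_univ_three, et_sub, et_add, et_add, et_smul, et_smul, et_smul,
      et_rxi_eq_ite, et_rxi_eq_ite, et_rxi_eq_ite]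
    fin_cases d <;> simp
  obtain ⟨Y, Z, hY, hZ, h⟩ := ThreeQS.horiz_split (F := F) _ hh
  exact ⟨Y + (X - horComp F V X), Z, ⟨Y, _, hY, hv, rfl⟩, hZ, by rw [h]; abel⟩

theorem inE4l3_of_gm {W : V} (h : ∀ X, InE4m F V X → gm F V W X = 0) : InE4l3 F V W := by
  obtain ⟨Y, Z, hY, hZ, rfl⟩ := exists_inE4l3_add_inE4m (F := F) W
  have hZ0 : Z = 0 := eq_zero_of_gm (F := F) fun X => by
    obtain ⟨Y', Z', hY', hZ', rfl⟩ := exists_inE4l3_add_inE4m (F := F) X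
    have h1 := h Z' hZ'
    rw [gm_add_left, hY.gm_eq_zero hZ', zero_add] at h1
    rw [gm_add_left, hY'.gm_eq_zero hZ, gm_comm, h1, add_zero]
  rwa [hZ0, add_zero]

theorem InE4l.dEtaEnd_eq {X : V} (hX : InE4l F V X) (a : Fin 3) :
    QS3.dEtaEnd (F := F) a X = algebraMap ℝ F (cc F V) • ph F V a X := by
  set U := QS3.dEtaEnd (F := F) a X - algebraMap ℝ F (cc F V) • ph F V a X with hUdef
  have hU : InE4l F V U := (hX.dEtaEnd a).sub ((ThreeQS.phi_E4l a X hX).smul _)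
  have h := cyclic_add a
  have ha : QS3.dEtaEnd (F := F) a U = 0 := by
    rw [hUdef, dEtaEnd_sub, dEtaEnd_smul, hX.1.dEtaEnd_sq, hX.1.dEtaEnd_ph, sub_self]
  have hm : InE4m F V U := inE4m_of_dEtaEnd hU.1 fun d => by
    rcases h.cases d with rfl | rfl | rfl
    · exact ha
    · rw [hU.1.dEtaEnd_eq_ph h, ha, ph_zero]
    · rw [hU.1.dEtaEnd_eq_neg_ph h.rotate, ha, ph_zero, neg_zero]
  have hU0 : U = 0 := eq_zero_of_gm (F := F) fun Z => by
    obtain ⟨Y', Z', hY', hZ', rfl⟩ := exists_inE4l3_add_inE4m (F := F) Z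
    rw [gm_add_left, hY'.gm_eq_zero hm, gm_comm, hU.2 Z' hZ', add_zero]
  exact sub_eq_zero.1 hU0

theorem dEtaEnd_rxi (a d : Fin 3) :
    dEtaEnd (F := F) a (rxi F V d) = algebraMap ℝ F (cc F V) • ph F V a (rxi F V d) := by
  refine eq_of_gm (F := F) fun Z => ?_
  rw [gm_dEtaEnd_right, ← et_eq, et_dEtaEnd]
  have h := cyclic_add a
  rcases h.cases d with rfl | rfl | rfl
  · rw [et_lie_rxi_self, ph_rxi_self, smul_zero, gm_zero_right]; ring
  · rw [der_rxi_et' h, ph_rxi h, gm_smul_right, ← et_eq]; ring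
  · rw [der_rxi_et h.rotate.rotate, ph_rxi' h.rotate.rotate, gm_smul_right, gm_neg_right,
      ← et_eq]; ring

theorem InE4l3.dEtaEnd_eq {X : V} (hX : InE4l3 F V X) (a : Fin 3) :
    QS3.dEtaEnd (F := F) a X = algebraMap ℝ F (cc F V) • ph F V a X := by
  obtain ⟨Y, Z, hY, ⟨p, q, r, rfl⟩, rfl⟩ := hX
  simp only [dEtaEnd_add, dEtaEnd_smul, ph_add, ph_smul, hY.dEtaEnd_eq, dEtaEnd_rxi]
  module

end reeb

section foliation

variable {F V : Type} [CommRing F] [Algebra ℝ F] [AddCommGroup V] [Module F V]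
  [SmoothSetting F V] [ACM3 F V]

section leviCivita

variable [LeviCivita F V]

theorem nab_metric (X Y Z : V) :
    der F V X (gm F V Y Z) = gm F V (nab F V X Y) Z + gm F V Y (nab F V X Z) :=
  LeviCivita.nabla_metric X Y Z

theorem lie_eq_nab (X Y : V) : lie F V X Y = nab F V X Y - nab F V Y X :=
  (LeviCivita.nabla_torsionFree X Y).symm

theorem nab_neg (X Y : V) : nab F V X (-Y) = -nab F V X Y := by
  have hadd : ∀ Y Z : V, nab F V X (Y + Z) = nab F V X Y + nab F V X Z :=
    LeviCivita.nabla_addRight X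
  have h0 : nab F V X 0 = 0 := by simpa using hadd 0 0
  rw [← add_eq_zero_iff_eq_neg, ← hadd, neg_add_cancel, h0]

/-- The covariant derivative `g((∇_X φ_a) Y, Z)` as a trilinear form. -/
def covPh (a : Fin 3) (X Y Z : V) : F :=
  gm F V (nab F V X (ph F V a Y) - ph F V a (nab F V X Y)) Z

theorem covPh_swap (a : Fin 3) (X Y Z : V) :
    covPh (F := F) a X Y Z = -covPh (F := F) a X Z Y := by
  have h1 := nab_metric (F := F) X (ph F V a Y) Z
  have h2 := nab_metric (F := F) X Y (ph F V a Z)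
  rw [gm_ph_left, der_neg] at h1
  simp only [covPh, gm_sub_left, gm_ph_left]
  rw [gm_comm _ Y, gm_comm (nab F V X Z), gm_ph_left] at *
  linear_combination -h1 - h2

end leviCivita

variable [ThreeQS F V]

theorem InE4l3.add {X Y : V} (hX : InE4l3 F V X) (hY : InE4l3 F V Y) : InE4l3 F V (X + Y) :=
  inE4l3_of_gm fun Z hZ => by
    rw [gm_add_left, hX.gm_eq_zero hZ, hY.gm_eq_zero hZ, add_zero]

theorem InE4l3.ph {X : V} (hX : InE4l3 F V X) (a : Fin 3) : InE4l3 F V (QS3.ph F V a X) :=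
  inE4l3_of_gm fun Z hZ => by
    rw [gm_ph_left, hX.gm_eq_zero (ThreeQS.phi_E4m a Z hZ), neg_zero]

theorem inE4m_of_gm {X : V} (h : ∀ W, InE4l3 F V W → gm F V X W = 0) : InE4m F V X := by
  obtain ⟨Y, Z, hY, hZ, rfl⟩ := exists_inE4l3_add_inE4m (F := F) X
  have hY0 : Y = 0 := eq_zero_of_gm (F := F) fun W => by
    obtain ⟨Y', Z', hY', hZ', rfl⟩ := exists_inE4l3_add_inE4m (F := F) W
    have h1 := h Y' hY'
    rw [gm_add_left, gm_comm Z, hY'.gm_eq_zero hZ, add_zero] at h1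
    rw [gm_add_left, gm_comm Z', hY.gm_eq_zero hZ', gm_comm, h1, add_zero]
  rwa [hY0, zero_add]

theorem InE4l3.dOne_et_eq {X Y : V} (hY : InE4l3 F V Y) (a : Fin 3) :
    dOne F V (et F V a) X Y = algebraMap ℝ F (cc F V / 2) * Phi F V a X Y := by
  rw [dOne_eq, extDer_et_eq, hY.dEtaEnd_eq, gm_smul_right, Algebra.smul_def, Phi,
    div_eq_inv_mul, map_mul, mul_assoc]

/-- The transverse part of the fundamental form: the closed 2-form `c Φ_a - 2 dη_a`. -/
def transPhi (a : Fin 3) (X Y : V) : F :=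
  algebraMap ℝ F (cc F V) * Phi F V a X Y - extDer (et F V a) X Y

theorem extDerTwo_transPhi (a : Fin 3) (X Y Z : V) :
    extDerTwo (transPhi (F := F) a) X Y Z = 0 := by
  have h1 := extDerTwo_Phi (F := F) a X Y Z
  have h2 := extDerTwo_extDer (et_add (F := F) a) X Y Z
  rw [extDerTwo] at h1 h2
  simp only [extDerTwo, transPhi, der_sub, der_const_mul]
  linear_combination algebraMap ℝ F (cc F V) * h1 - h2

theorem transPhi_swap (a : Fin 3) (X Y : V) :
    transPhi (F := F) a X Y = -transPhi (F := F) a Y X := by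
  rw [transPhi, transPhi, Phi_swap, extDer_et_swap]; ring

theorem InE4l3.transPhi_right {W : V} (hW : InE4l3 F V W) (a : Fin 3) (X : V) :
    transPhi (F := F) a X W = 0 := by
  rw [transPhi, extDer_et_eq, hW.dEtaEnd_eq, gm_smul_right, Phi, sub_self]

theorem InE4l3.transPhi_left {W : V} (hW : InE4l3 F V W) (a : Fin 3) (X : V) :
    transPhi (F := F) a W X = 0 := by
  rw [transPhi_swap, hW.transPhi_right, neg_zero]

theorem InE4m.transPhi_right {Y : V} (hY : InE4m F V Y) (a : Fin 3) (X : V) :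
    transPhi (F := F) a X Y = algebraMap ℝ F (cc F V) * Phi F V a X Y := by
  rw [transPhi, extDer_et_eq, hY.dEtaEnd_eq_zero, gm_zero_right, sub_zero]

theorem InE4l3.lie (hc : cc F V ≠ 0) {X Y : V} (hX : InE4l3 F V X) (hY : InE4l3 F V Y) :
    InE4l3 F V (QS3.lie F V X Y) :=
  inE4l3_of_gm fun Z hZ => by
    have h := extDerTwo_transPhi (F := F) 0 X Y (QS3.ph F V 0 Z)
    rw [extDerTwo, hY.transPhi_left, hX.transPhi_right, hX.transPhi_left, hX.transPhi_right,
      hY.transPhi_right, (ThreeQS.phi_E4m 0 Z hZ).transPhi_right, Phi, hZ.1.ph_ph,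
      gm_neg_right] at h
    simp only [der_zero] at h
    exact eq_zero_of_const_mul hc (by linear_combination h)

theorem InE4l3.der_Phi (hc : cc F V ≠ 0) {W X Y : V} (hW : InE4l3 F V W) (hX : InE4m F V X)
    (hY : InE4m F V Y) (a : Fin 3) :
    der F V W (Phi F V a X Y)
      = Phi F V a (QS3.lie F V W X) Y + Phi F V a X (QS3.lie F V W Y) := by
  have h := extDerTwo_transPhi (F := F) a W X Y
  have h1 : transPhi (F := F) a (QS3.lie F V Y W) X
      = algebraMap ℝ F (cc F V) * Phi F V a X (QS3.lie F V W Y) := by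
    rw [hX.transPhi_right, Phi_swap, lie_swap, Phi, Phi, ph_neg, gm_neg_right]; ring
  rw [extDerTwo, hW.transPhi_right, hW.transPhi_left, hW.transPhi_right, h1,
    hY.transPhi_right, hY.transPhi_right, der_const_mul, der_zero, der_zero] at h
  exact sub_eq_zero.1 (eq_zero_of_const_mul hc (by linear_combination h))

/-- Along `E^{4l+3}` the tensors `φ_a` are preserved transversally. -/
theorem InE4l3.lie_ph_sub (hc : cc F V ≠ 0) {W Y : V} (hW : InE4l3 F V W) (hY : InE4m F V Y)
    (c : Fin 3) :
    InE4l3 F V (QS3.lie F V W (QS3.ph F V c Y) - QS3.ph F V c (QS3.lie F V W Y)) :=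
  inE4l3_of_gm fun Z hZ => by
    have h : Cyclic c (c + 1) (c + 2) := cyclic_add c
    have hY' := ThreeQS.phi_E4m c Y hY
    have key : ∀ X, InE4m F V X →
        gm F V (QS3.ph F V (c + 1) X)
          (QS3.lie F V W (QS3.ph F V c Y) - QS3.ph F V c (QS3.lie F V W Y)) = 0 := by
      intro X hX
      have h1 := hW.der_Phi hc hX hY' (c + 1)
      have h2 := hW.der_Phi hc hX hY (c + 2)
      have h3 := hX.1 (c + 1)
      rw [et_eq] at h3
      simp only [Phi, ph_eq_neg_ph_ph h, gm_add_right, gm_neg_right, gm_smul_right, h3,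
        hY.1 c, der_neg, der_add, zero_mul, mul_zero, der_zero] at h1 h2
      rw [gm_sub_right, gm_ph_left, gm_ph_left]
      linear_combination h1 + h2
    have h4 := key _ (ThreeQS.phi_E4m (c + 1) Z hZ)
    rw [hZ.1.ph_ph, gm_neg_left, gm_comm] at h4
    exact neg_eq_zero.1 h4

theorem InE4l3.der_gm (hc : cc F V ≠ 0) {W X Y : V} (hW : InE4l3 F V W) (hX : InE4m F V X)
    (hY : InE4m F V Y) :
    der F V W (gm F V X Y) = gm F V (QS3.lie F V W X) Y + gm F V X (QS3.lie F V W Y) := by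
  have h1 := hW.der_Phi hc hX (ThreeQS.phi_E4m 0 Y hY) 0
  have h2 := (hW.lie_ph_sub hc hY 0).gm_eq_zero (ThreeQS.phi_E4m 0 X hX)
  rw [gm_comm, gm_sub_right, gm_ph_ph, hX.1, gm_ph_left] at h2
  simp only [Phi, hY.1.ph_ph, gm_neg_right, der_neg] at h1
  linear_combination -h1 + h2

theorem BasicE4l3.ph (hc : cc F V ≠ 0) {X : V} (hX : BasicE4l3 F V X) (a : Fin 3) :
    BasicE4l3 F V (QS3.ph F V a X) := by
  refine ⟨ThreeQS.phi_E4m a X hX.1, fun W hW => ?_⟩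
  have h := (hW.lie_ph_sub hc hX.1 a).add ((hX.2 W hW).ph a)
  rwa [sub_add_cancel] at h

theorem InE4m.lie {X Y : V} (hX : InE4m F V X) (hY : InE4m F V Y) :
    InE4m F V (QS3.lie F V X Y) := by
  refine ⟨fun a => ?_, fun a Z => ?_⟩
  · have h := (dOne_eq_zero_iff _ _ _).1 (hX.2 a Y)
    rw [extDer, hX.1, hY.1, der_zero, der_zero] at h
    linear_combination -h
  · have h := extDerTwo_extDer (et_add (F := F) a) X Y Z
    have hr : ∀ {U : V}, InE4m F V U → ∀ Z, extDer (et F V a) Z U = 0 := fun hU Z => by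
      rw [extDer_et_eq, hU.dEtaEnd_eq_zero, gm_zero_right]
    rw [extDerTwo, extDer_et_swap a Y Z, hr hX, hr hY, hr hY, hr hX, hr hY] at h
    simp only [neg_zero, der_zero] at h
    rw [dOne_eq_zero_iff]
    linear_combination -h

section connection

variable [LeviCivita F V]

/-- The leaves of `E^{4m}` are totally geodesic. -/
theorem InE4m.nab (hc : cc F V ≠ 0) {X Y : V} (hX : InE4m F V X) (hY : InE4m F V Y) :
    InE4m F V (QS3.nab F V X Y) :=
  inE4m_of_gm fun W hW => by
    have horth : ∀ U Z, InE4m F V Z →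
        gm F V (QS3.nab F V U Z) W = -gm F V Z (QS3.nab F V U W) := fun U Z hZ => by
      have h := nab_metric (F := F) U Z W
      rw [gm_comm Z W, hW.gm_eq_zero hZ, der_zero] at h
      linear_combination -h
    have h1 := hW.der_gm hc hX hY
    rw [nab_metric, lie_eq_nab, lie_eq_nab, gm_sub_left, gm_sub_right,
      gm_comm (QS3.nab F V X W)] at h1
    have h2 := hW.gm_eq_zero (hX.lie hY)
    rw [lie_eq_nab, gm_comm, gm_sub_left] at h2
    exact eq_zero_of_add_self
      (by linear_combination -h1 + h2 + horth X Y hY + horth Y X hX)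

theorem covPh_cyclic (a : Fin 3) (X Y Z : V) :
    covPh (F := F) a X Y Z + covPh (F := F) a Y Z X + covPh (F := F) a Z X Y = 0 := by
  have h := extDerTwo_Phi (F := F) a X Y Z
  simp only [extDerTwo, Phi, nab_metric, lie_eq_nab, gm_sub_left] at h
  simp only [covPh_swap a X Y, covPh_swap a Y Z, covPh_swap a Z X]
  simp only [covPh, gm_sub_left, gm_ph_left]
  rw [gm_comm _ Y, gm_comm _ Z, gm_comm _ X]
  linear_combination -h

theorem covPh_ph (hc : cc F V ≠ 0) {X Y : V} (hX : InE4m F V X) (hY : InE4m F V Y)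
    (a : Fin 3) (Z : V) :
    covPh (F := F) a X (ph F V a Y) Z = covPh (F := F) a X Y (ph F V a Z) := by
  rw [covPh, covPh, hY.1.ph_ph, nab_neg, ← neg_neg (gm F V _ (ph F V a Z)), ← gm_ph_left, ph_sub,
    (hX.nab hc hY).1.ph_ph, ← gm_neg_left]
  congr 1
  abel

theorem covPh_normality {X : V} (hX : InE4m F V X) (Y : V) (a : Fin 3) (Z : V) :
    covPh (F := F) a (ph F V a X) Y Z - covPh (F := F) a (ph F V a Y) X Z
      + covPh (F := F) a X Y (ph F V a Z) - covPh (F := F) a Y X (ph F V a Z) = 0 := by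
  have h := congrArg (fun U => gm F V U Z) (normality (F := F) a X Y)
  simp only [(dOne_eq_zero_iff _ _ _).1 (hX.2 a Y), zero_smul, add_zero, lie_eq_nab, ph_sub,
    gm_sub_left, gm_add_left, gm_zero_left, gm_ph_left] at h
  simp only [covPh, gm_sub_left, gm_ph_left]
  linear_combination h

theorem covPh_eq_zero (hc : cc F V ≠ 0) {X Y Z : V} (hX : InE4m F V X) (hY : InE4m F V Y)
    (hZ : InE4m F V Z) (a : Fin 3) : covPh (F := F) a X Y Z = 0 := by
  have hY' := ThreeQS.phi_E4m a Y hY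
  have hZ' := ThreeQS.phi_E4m a Z hZ
  have h1 := covPh_cyclic (F := F) a X Y Z
  have h2 := covPh_cyclic (F := F) a X (ph F V a Y) (ph F V a Z)
  have h3 := covPh_normality hY Z a (ph F V a X)
  rw [covPh_ph hc hX hY, hZ.1.ph_ph, covPh_ph hc hY' hZ, covPh_swap a (ph F V a Z) X,
    covPh_ph hc hZ' hY] at h2
  rw [hX.1.ph_ph] at h3
  have h4 := covPh_swap (F := F) a Z X Y
  simp only [covPh, gm_neg_right] at *
  exact eq_zero_of_add_self (by linear_combination h1 - h2 + h3 - h4)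

theorem InE4m.nab_ph (hc : cc F V ≠ 0) {X Y : V} (hX : InE4m F V X) (hY : InE4m F V Y)
    (a : Fin 3) : QS3.nab F V X (ph F V a Y) = ph F V a (QS3.nab F V X Y) := by
  refine sub_eq_zero.1 (eq_zero_of_gm (F := F) fun Z => ?_)
  obtain ⟨W, Z, hW, hZ, rfl⟩ := exists_inE4l3_add_inE4m (F := F) Z
  have h1 := covPh_eq_zero hc hX hY hZ a
  rw [covPh] at h1
  rw [gm_add_left, gm_comm Z, h1, gm_sub_right,
    hW.gm_eq_zero (hX.nab hc (ThreeQS.phi_E4m a Y hY)),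
    hW.gm_eq_zero (ThreeQS.phi_E4m a _ (hX.nab hc hY)), sub_zero, add_zero]

end connection

end foliation

/-- In a 3-quasi-Sasakian manifold of rank `4l+3` the
distribution `E^{4l+3} = E^{4l} ⊕ V` is integrable and defines a Riemannian
foliation whose leaves are 3-α-Sasakian (`α = c/2`), and the `φ_α`, the
fundamental 2-forms `Φ_α` and the metric project onto a hyper-Kähler structure
on the (local) leaf space. -/
theorem e4l3_foliation (F V : Type) [CommRing F] [Algebra ℝ F] [AddCommGroup V] [Module F V]
    [SmoothSetting F V] [ACM3 F V] [ThreeQS F V] [LeviCivita F V]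
    (l : ℕ) [HasRank F V l] :
    (∀ X Y : V, InE4l3 F V X → InE4l3 F V Y → InE4l3 F V (lie F V X Y)) ∧
    (∀ W X Y : V, InE4l3 F V W → InE4m F V X → InE4m F V Y →
      der F V W (gm F V X Y)
        = gm F V (lie F V W X) Y + gm F V X (lie F V W Y)) ∧
    (∀ (α : Fin 3) (X : V), InE4l3 F V X → InE4l3 F V (ph F V α X)) ∧
    (cc F V / 2 ≠ 0 ∧
      ∀ (α : Fin 3) (X Y : V), InE4l3 F V X → InE4l3 F V Y →
        dOne F V (et F V α) X Y = algebraMap ℝ F (cc F V / 2) * Phi F V α X Y) ∧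
    (∀ (α : Fin 3) (W X Y : V), InE4l3 F V W → InE4m F V X → InE4m F V Y →
      der F V W (Phi F V α X Y)
        = Phi F V α (lie F V W X) Y + Phi F V α X (lie F V W Y)) ∧
    (∀ (α : Fin 3) (X : V), BasicE4l3 F V X → BasicE4l3 F V (ph F V α X)) ∧
    (∀ a b c' : Fin 3, Cyclic a b c' → ∀ X : V, InE4m F V X →
      ph F V c' X = ph F V a (ph F V b X)) ∧
    (∀ (α : Fin 3) (X Y : V), InE4m F V X → InE4m F V Y →
      gm F V (ph F V α X) (ph F V α Y) = gm F V X Y) ∧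
    (∀ (α : Fin 3) (X Y : V), InE4m F V X → InE4m F V Y →
      nab F V X (ph F V α Y) = ph F V α (nab F V X Y)) := by
  have hc : cc F V ≠ 0 := HasRank.c_ne l
  refine ⟨fun X Y hX hY => hX.lie hc hY, fun W X Y hW hX hY => hW.der_gm hc hX hY,
    fun a X hX => hX.ph a, ⟨div_ne_zero hc two_ne_zero, fun a X Y _ hY => hY.dOne_et_eq a⟩,
    fun a W X Y hW hX hY => hW.der_Phi hc hX hY a, fun a X hX => hX.ph hc a,
    fun a b c h X hX => (hX.1.ph_ph_of_cyclic h).symm, fun a X Y hX hY => ?_,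
    fun a X Y hX hY => hX.nab_ph hc hY a⟩
  rw [gm_ph_ph, hX.1, zero_mul, sub_zero]

end QS3
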